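/- For n = 3 and λ > 0, the function g_λ^x(y) = e^{−√λ ‖x−y‖} / (4π‖x−y‖) satisfies (−Δ + λ) g_λ^x = δ_x in the sense of distributions on ℝ³. -/

import Mathlib

open MeasureTheory Filter Topology

abbrev E3 := EuclideanSpace ℝ (Fin 3)

noncomputable def F0 (k q : ℝ) : ℝ := Real.exp (-k * √q) / √q
noncomputable def F1 (k q : ℝ) : ℝ := -(k / √q^2 + 1/√q^3) * Real.exp (-k * √q) / 2
noncomputable def F2 (k q : ℝ) : ℝ := (k^2 / √q^3 + 3*k/√q^4 + 3/√q^5) * Real.exp (-k * √q) / 4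

lemma hasDerivAt_F0 (k q : ℝ) (hq : 0 < q) : HasDerivAt (F0 k) (F1 k q) q := by
  have hs : 0 < √q := Real.sqrt_pos.2 hq
  have h := Real.hasDerivAt_sqrt hq.ne'
  have h1 : HasDerivAt (F0 k) _ q := ((h.const_mul (-k)).exp).div h hs.ne'
  convert h1 using 1
  unfold F1
  field_simp
  ring

lemma hasDerivAt_F1 (k q : ℝ) (hq : 0 < q) : HasDerivAt (F1 k) (F2 k q) q := by
  have hs : 0 < √q := Real.sqrt_pos.2 hq
  have h := Real.hasDerivAt_sqrt hq.ne'
  have h1 : HasDerivAt (F1 k) _ q := ((((((hasDerivAt_const q k).div (h.pow 2) (pow_ne_zero _ hs.ne')).add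
    ((hasDerivAt_const q 1).div (h.pow 3) (pow_ne_zero _ hs.ne'))).neg).mul 
    ((h.const_mul (-k)).exp)).div_const 2)
  convert h1 using 1
  unfold F2
  simp
  field_simp
  ring

lemma F_identity (k e r : ℝ) (he : 0 < e) :
    4 * F2 k (r^2 + e^2) * r^2 + 6 * F1 k (r^2+e^2) =
      k^2 * F0 k (r^2+e^2) - 4 * e^2 * F2 k (r^2+e^2) := by
  have hq : 0 < r^2+e^2 := by positivity
  have hs : 0 < √(r^2+e^2) := Real.sqrt_pos.2 hq
  have h2 : √(r^2+e^2)^2 = r^2 + e^2 := Real.sq_sqrt hq.le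
  have hr : r^2 = √(r^2+e^2)^2 - e^2 := by rw [h2]; ring
  unfold F0 F1 F2
  set s := √(r^2+e^2) with hsdef
  clear_value s
  rw [hr]
  field_simp
  ring

lemma continuousOn_F2 (k : ℝ) : ContinuousOn (F2 k) (Set.Ioi 0) := by
  intro q hq
  have hs : 0 < √q := Real.sqrt_pos.2 hq
  apply ContinuousAt.continuousWithinAt
  unfold F2
  have : √q ≠ 0 := hs.ne'
  fun_prop (disch := positivity)

/-- integration by parts twice -/
lemma ibp2 (G G1 G2 : E3 → ℝ) (v : E3) (φ : E3 → ℝ) (hφ : ContDiff ℝ (⊤ : ℕ∞) φ)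
    (hsupp : HasCompactSupport φ) (hG : Differentiable ℝ G) (hG1 : Differentiable ℝ G1)
    (h1 : ∀ y, fderiv ℝ G y v = G1 y) (h2 : ∀ y, fderiv ℝ G1 y v = G2 y) (hG2 : Continuous G2) :
    (∫ y, G y * fderiv ℝ (fun z => fderiv ℝ φ z v) y v) = ∫ y, G2 y * φ y := by
  set φ1 : E3 → ℝ := fun z => fderiv ℝ φ z v with hφ1
  have c1 : ContDiff ℝ (⊤ : ℕ∞) φ1 := by
    have := hφ.fderiv_right (m := (⊤ : ℕ∞)) (by simp)
    exact this.clm_apply contDiff_const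
  have c2 : ContDiff ℝ (⊤ : ℕ∞) (fun y => fderiv ℝ φ1 y v) := by
    have := c1.fderiv_right (m := (⊤ : ℕ∞)) (by simp)
    exact this.clm_apply contDiff_const
  have s1 : HasCompactSupport φ1 := hsupp.fderiv_apply ℝ v
  have s2 : HasCompactSupport (fun y => fderiv ℝ φ1 y v) := s1.fderiv_apply ℝ v
  have I : ∀ (a b : E3 → ℝ), Continuous a → Continuous b → HasCompactSupport b →
      Integrable (fun y => a y * b y) := fun a b ha hb hs =>
    (ha.mul hb).integrable_of_hasCompactSupport hs.mul_left
  rw [integral_mul_fderiv_eq_neg_fderiv_mul_of_integrable, ← integral_neg]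
  · simp only [h1]
    have := integral_mul_fderiv_eq_neg_fderiv_mul_of_integrable (μ := (volume : Measure E3)) (f := G1) (g := φ) (v := v)
      (by simp only [h2]; exact I _ _ hG2 hφ.continuous hsupp)
      (I _ _ hG1.continuous c1.continuous s1) (I _ _ hG1.continuous hφ.continuous hsupp)
      (fun _ _ => hG1 _) (fun _ _ => hφ.differentiable (by simp) _)
    rw [integral_neg]
    simp only [h2] at this
    rw [← neg_neg (∫ y, G2 y * φ y), ← this]
  · simp only [h1]; exact I _ _ hG1.continuous c1.continuous s1
  · exact I _ _ hG.continuous c2.continuous s2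
  · exact I _ _ hG.continuous c1.continuous s1
  · exact fun _ _ => hG _
  · exact fun _ _ => c1.differentiable (by simp) _

lemma hq_deriv (e : ℝ) (x y : E3) :
    HasFDerivAt (fun y : E3 => ‖y - x‖^2 + e^2) (2 • innerSL ℝ (y - x)) y := by
  have := ((hasFDerivAt_id y).sub_const x).norm_sq.add_const (e^2)
  simpa using this

lemma lap_eq (k e : ℝ) (he : 0 < e) (x : E3) (φ : E3 → ℝ) (hφ : ContDiff ℝ (⊤ : ℕ∞) φ)
    (hsupp : HasCompactSupport φ) (i : Fin 3) :
    (∫ y, F0 k (‖y - x‖^2 + e^2) * fderiv ℝ (fun z => fderiv ℝ φ z (EuclideanSpace.single i 1)) y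
      (EuclideanSpace.single i 1)) =
    ∫ y, (4 * F2 k (‖y - x‖^2 + e^2) * (y i - x i)^2 + 2 * F1 k (‖y - x‖^2 + e^2)) * φ y := by
  have hq : ∀ y : E3, 0 < ‖y - x‖^2 + e^2 := fun y => by positivity
  have d0 : ∀ y : E3, HasFDerivAt (fun y : E3 => F0 k (‖y - x‖^2 + e^2)) 
    (F1 k (‖y - x‖^2 + e^2) • (2 • innerSL ℝ (y - x))) y := fun y =>
    HasDerivAt.comp_hasFDerivAt (h₂ := F0 k) y (hasDerivAt_F0 k _ (hq y)) (hq_deriv e x y)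
  have d1 : ∀ y : E3, HasFDerivAt (fun y : E3 => F1 k (‖y - x‖^2 + e^2)) 
    (F2 k (‖y - x‖^2 + e^2) • (2 • innerSL ℝ (y - x))) y := fun y =>
    HasDerivAt.comp_hasFDerivAt (h₂ := F1 k) y (hasDerivAt_F1 k _ (hq y)) (hq_deriv e x y)
  have d2 : ∀ y : E3, HasFDerivAt (fun y : E3 => 2 * (y i - x i)) 
    ((2:ℝ) • (EuclideanSpace.proj i : E3 →L[ℝ] ℝ)) y := fun y =>
     (((EuclideanSpace.proj i : E3 →L[ℝ] ℝ).hasFDerivAt).sub_const (x i)).const_mul 2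
  have d3 : ∀ y : E3, HasFDerivAt (fun y : E3 => F1 k (‖y - x‖^2 + e^2) * (2 * (y i - x i))) _ y :=
    fun y => (d1 y).mul (d2 y)
  refine ibp2 _ (fun y => F1 k (‖y - x‖^2 + e^2) * (2 * (y i - x i))) _ _ φ hφ hsupp 
    (fun y => (d0 y).differentiableAt) (fun y => (d3 y).differentiableAt) ?_ ?_ ?_
  · intro y
    rw [(d0 y).fderiv]
    simp [EuclideanSpace.inner_single_right]
  · intro y
    rw [HasFDerivAt.fderiv (d3 y)]
    simp [EuclideanSpace.inner_single_right]
    ring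
  · have c1 : Continuous (fun y : E3 => F1 k (‖y - x‖^2 + e^2)) := 
      continuous_iff_continuousAt.2 fun y => (d1 y).continuousAt
    have c2 : Continuous (fun y : E3 => F2 k (‖y - x‖^2 + e^2)) := 
      (continuousOn_F2 k).comp_continuous (by fun_prop) hq
    fun_prop


lemma cont_F0 (k e : ℝ) (he : 0 < e) (x : E3) : Continuous fun y : E3 => F0 k (‖y - x‖^2 + e^2) := by
  have hq : ∀ y : E3, √(‖y - x‖^2 + e^2) ≠ 0 := fun y => (Real.sqrt_pos.2 (by positivity)).ne'
  unfold F0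
  fun_prop (disch := exact hq _)

lemma cont_F1 (k e : ℝ) (he : 0 < e) (x : E3) : Continuous fun y : E3 => F1 k (‖y - x‖^2 + e^2) := by
  have hq : ∀ y : E3, √(‖y - x‖^2 + e^2) ≠ 0 := fun y => (Real.sqrt_pos.2 (by positivity)).ne'
  unfold F1
  fun_prop (disch := exact fun y => pow_ne_zero _ (hq y))

lemma cont_F2 (k e : ℝ) (he : 0 < e) (x : E3) : Continuous fun y : E3 => F2 k (‖y - x‖^2 + e^2) :=
  (continuousOn_F2 k).comp_continuous (by fun_prop) fun y => by
    show 0 < ‖y - x‖^2 + e^2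
    positivity

noncomputable def dd (φ : E3 → ℝ) (i : Fin 3) (y : E3) : ℝ :=
  fderiv ℝ (fun z => fderiv ℝ φ z (EuclideanSpace.single i 1)) y (EuclideanSpace.single i 1)

lemma dd_cont (φ : E3 → ℝ) (hφ : ContDiff ℝ (⊤ : ℕ∞) φ) (i : Fin 3) : Continuous (dd φ i) := by
  have c1 : ContDiff ℝ (⊤ : ℕ∞) (fun z => fderiv ℝ φ z (EuclideanSpace.single i 1)) := by
    have := hφ.fderiv_right (m := (⊤ : ℕ∞)) (by simp)
    exact this.clm_apply contDiff_const
  have := c1.fderiv_right (m := (⊤ : ℕ∞)) (by simp)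
  exact (this.clm_apply contDiff_const).continuous

lemma dd_supp (φ : E3 → ℝ) (hsupp : HasCompactSupport φ) (i : Fin 3) :
    HasCompactSupport (dd φ i) := (hsupp.fderiv_apply ℝ _).fderiv_apply ℝ _

lemma reg_eq (k e : ℝ) (he : 0 < e) (x : E3) (φ : E3 → ℝ) (hφ : ContDiff ℝ (⊤ : ℕ∞) φ)
    (hsupp : HasCompactSupport φ) :
    (∫ y, F0 k (‖y - x‖^2 + e^2) * (-(∑ i, dd φ i y) + k^2 * φ y)) =
    ∫ y, 4 * e^2 * F2 k (‖y - x‖^2 + e^2) * φ y := by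
  have I : ∀ (a b : E3 → ℝ), Continuous a → Continuous b → HasCompactSupport b →
      Integrable (fun y => a y * b y) := fun a b ha hb hs =>
    (ha.mul hb).integrable_of_hasCompactSupport hs.mul_left
  have c0 := cont_F0 k e he x
  have c1 := cont_F1 k e he x
  have c2 := cont_F2 k e he x
  have h0 : ∀ y, F0 k (‖y - x‖^2 + e^2) * (-(∑ i, dd φ i y) + k^2 * φ y) =
    -(∑ i, F0 k (‖y - x‖^2 + e^2) * dd φ i y) + (k^2 * F0 k (‖y - x‖^2 + e^2)) * φ y := by
    intro y
    rw [← Finset.mul_sum]; ring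
  have J0 := fun i => I _ _ c0 (dd_cont φ hφ i) (dd_supp φ hsupp i)
  have J1 := I _ _ (c0.const_mul (k^2)) hφ.continuous hsupp
  have J2 : ∀ i : Fin 3, Integrable (fun y : E3 =>
      (4 * F2 k (‖y - x‖^2 + e^2) * (y i - x i)^2 + 2 * F1 k (‖y - x‖^2 + e^2)) * φ y) :=
    fun i => I _ _ (by fun_prop) hφ.continuous hsupp
  have J0' : Integrable (fun y => -∑ i, F0 k (‖y - x‖^2 + e^2) * dd φ i y) :=
    (integrable_finsetSum _ fun i _ => J0 i).neg
  have J2' : Integrable (fun y : E3 => -∑ i : Fin 3,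
      (4 * F2 k (‖y - x‖^2 + e^2) * (y i - x i)^2 + 2 * F1 k (‖y - x‖^2 + e^2)) * φ y) :=
    (integrable_finsetSum _ fun i _ => J2 i).neg
  simp_rw [h0]
  rw [integral_add J0' J1, integral_neg,
    integral_finsetSum _ fun i _ => J0 i]
  have h3 : ∀ i, (∫ y, F0 k (‖y - x‖^2 + e^2) * dd φ i y) = _ := lap_eq k e he x φ hφ hsupp
  simp_rw [h3]
  rw [← integral_finsetSum _ fun i _ => J2 i, ← integral_neg, ← integral_add J2' J1]
  congr 1
  ext y
  have h4 := F_identity k e ‖y - x‖ he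
  have h5 : ‖y - x‖^2 = ∑ i, (y i - x i)^2 := by
    simp [EuclideanSpace.real_norm_sq_eq]
  rw [Fin.sum_univ_three] at *
  have h6 : (4 * e^2 * F2 k (‖y - x‖^2 + e^2)) = k ^ 2 * F0 k (‖y - x‖^2 + e^2)
    - (4 * F2 k (‖y - x‖^2 + e^2) * ((y 0 - x 0)^2 + (y 1 - x 1)^2 + (y 2 - x 2)^2) 
      + 6 * F1 k (‖y - x‖^2 + e^2)) := by
    rw [← h5, h4]; ring
  rw [h6]
  ring

noncomputable def K (k e t : ℝ) : ℝ :=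
  (k^2*e^2 / t^3 + 3*k*e/t^4 + 3/t^5) * Real.exp (-k * e * t)

lemma scale_eq (k e : ℝ) (he : 0 < e) (x : E3) (φ : E3 → ℝ) :
    (∫ y, 4 * e^2 * F2 k (‖y - x‖^2 + e^2) * φ y) =
    ∫ z : E3, K k e (√(‖z‖^2 + 1)) * φ (x + e • z) := by
  rw [← integral_add_left_eq_self _ x]
  have := Measure.integral_comp_smul (volume : Measure E3) 
    (fun y => 4 * e^2 * F2 k (‖x + y - x‖^2 + e^2) * φ (x + y)) e
  rw [finrank_euclideanSpace_fin, abs_of_pos (by positivity), smul_eq_mul,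
    eq_inv_mul_iff_mul_eq₀ (by positivity)] at this
  rw [← this, ← integral_const_mul]
  congr 1
  ext z
  have h1 : ‖x + e • z - x‖^2 + e^2 = e^2 * (‖z‖^2+1) := by
    rw [add_sub_cancel_left, norm_smul, Real.norm_of_nonneg he.le]; ring
  rw [h1, F2, K, Real.sqrt_mul (by positivity), Real.sqrt_sq he.le]
  have hs : 0 < √(‖z‖^2+1) := Real.sqrt_pos.2 (by positivity)
  have h7 : -k * (e * √(‖z‖^2+1)) = -k * e * √(‖z‖^2+1) := by ring
  rw [h7]
  field_simp

lemma K_bound (k e t : ℝ) (hk : 0 < k) (he : 0 < e) (he1 : e ≤ 1) (ht : 1 ≤ t) :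
    |K k e t| ≤ (4 * k + 3) / t^4 := by
  have ht0 : 0 < t := by linarith
  rw [abs_of_nonneg (by unfold K; positivity), K]
  set X := Real.exp (-k * e * t)
  have hX0 : 0 ≤ X := (Real.exp_pos _).le
  have hX1 : X ≤ 1 := Real.exp_le_one_iff.2 (by have : 0 < k * e * t := by positivity
                                                linarith)
  have hX : k * e * t * X ≤ 1 := by
    have h1 := Real.add_one_le_exp (k * e * t)
    have h2 : Real.exp (k*e*t) * X = 1 := by
      rw [← Real.exp_add]; simp
    nlinarith
  have e1 : (k^2*e^2 / t^3 + 3*k*e/t^4 + 3/t^5) * X = 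
      (k * e * (k * e * t * X) + 3 * k * e * X + 3 * X / t) / t^4 := by
    field_simp
  rw [e1]
  refine div_le_div_of_nonneg_right ?_ (by positivity)
  have a1 : k * e * (k * e * t * X) ≤ k * 1 * 1 := by gcongr
  have a2 : 3 * k * e * X ≤ 3 * k * 1 * 1 := by gcongr
  have a3 : 3 * X / t ≤ 3 := by
    rw [div_le_iff₀ ht0]; linarith
  linarith

lemma int_t4 : Integrable (fun z : E3 => 1 / √(‖z‖^2+1)^4) := by
  have := integrable_rpow_neg_one_add_norm_sq (E := E3) (μ := volume) (r := 4) (by simp; norm_num)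
  refine this.congr (Eventually.of_forall fun z => ?_)
  have h : √(‖z‖^2+1)^4 = (1 + ‖z‖^2)^2 := by
    rw [show 4 = 2 * 2 from rfl, pow_mul, Real.sq_sqrt (by positivity)]; ring
  simp only [h]
  rw [show (-4/2 : ℝ) = -((2:ℕ):ℝ) by norm_num, Real.rpow_neg (by positivity), Real.rpow_natCast]
  simp

lemma int_t5 : ∫ z : E3, 3 / √(‖z‖^2+1)^5 = 4 * Real.pi := by
  have := integral_fun_norm_addHaar (volume : Measure E3) (fun r => 3 / √(r^2+1)^5)
  rw [this, finrank_euclideanSpace_fin]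
  have h : ∫ y in Set.Ioi (0:ℝ), y ^ (3 - 1) • (3 / √(y^2+1)^5) = 1 - (fun y => y^3 / √(y^2+1)^3) 0 := by
    refine integral_Ioi_of_hasDerivAt_of_nonneg' (g := fun y => y^3 / √(y^2+1)^3)
      (g' := fun y => y ^ (3 - 1) • (3 / √(y^2+1)^5)) ?_ ?_ ?_
    · intro y _
      have hs : 0 < √(y^2+1) := Real.sqrt_pos.2 (by positivity)
      have h2 : √(y^2+1)^2 = y^2 + 1 := Real.sq_sqrt (by positivity)
      have d1 : HasDerivAt (fun y : ℝ => y^2+1) (2 * y) y := by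
        simpa using (hasDerivAt_pow 2 y).add_const 1
      have d : HasDerivAt (fun y : ℝ => y^3 / √(y^2+1)^3) _ y :=
        (hasDerivAt_pow 3 y).div ((d1.sqrt (by positivity)).pow 3) (pow_ne_zero _ hs.ne')
      convert d using 1
      simp only [Nat.cast_ofNat, smul_eq_mul]
      norm_num
      field_simp
      rw [h2]
      ring
    · intro y hy
      have : 0 < y := hy
      positivity
    · have h1 : Tendsto (fun y : ℝ => √((1 + (y⁻¹)^2)⁻¹)^3) atTop (𝓝 (√((1 + 0^2)⁻¹)^3)) := by
        have := tendsto_inv_atTop_zero (𝕜 := ℝ)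
        exact ((Real.continuous_sqrt.tendsto _).comp
          (((tendsto_const_nhds.add (this.pow 2)).inv₀ (by norm_num)))).pow 3
      norm_num at h1
      refine h1.congr' ?_
      filter_upwards [eventually_gt_atTop 0] with y hy
      rw [← div_pow, ← inv_pow]
      congr 1
      rw [← Real.sqrt_inv, eq_div_iff (by positivity), ← Real.sqrt_mul (by positivity)]
      rw [show (1 + (y^2)⁻¹)⁻¹ * (y^2+1) = y^2 by field_simp]
      exact Real.sqrt_sq hy.le
  rw [h]
  simp [Measure.real]
  rw [ENNReal.toReal_ofReal (by positivity)]
  ring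

lemma rhs_tendsto (k : ℝ) (hk : 0 < k) (x : E3) (φ : E3 → ℝ) (hφ : Continuous φ)
    (hsupp : HasCompactSupport φ) :
    Tendsto (fun e : ℝ => ∫ z : E3, K k e (√(‖z‖^2 + 1)) * φ (x + e • z)) (𝓝[>] 0)
      (𝓝 (4 * Real.pi * φ x)) := by
  obtain ⟨C, hC⟩ := hsupp.exists_bound_of_continuous hφ
  rw [← int_t5, ← integral_mul_const]
  have ht : ∀ z : E3, 1 ≤ √(‖z‖^2+1) := fun z => Real.one_le_sqrt.2 (by nlinarith [sq_nonneg ‖z‖])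
  have ht0 : ∀ z : E3, √(‖z‖^2+1) ≠ 0 := fun z => by linarith [ht z]
  refine tendsto_integral_filter_of_dominated_convergence
    (fun z => (4 * k + 3) * (1 / √(‖z‖^2+1)^4) * C) ?_ ?_ ((int_t4.const_mul _).mul_const _) ?_
  · refine Eventually.of_forall fun e => Continuous.aestronglyMeasurable ?_
    unfold K
    fun_prop (disch := exact fun y => pow_ne_zero _ (ht0 y))
  · filter_upwards [Ioc_mem_nhdsGT zero_lt_one] with e he
    refine Eventually.of_forall fun z => ?_
    rw [norm_mul]
    have := K_bound k e _ hk he.1 he.2 (ht z)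
    rw [Real.norm_eq_abs]
    rw [mul_one_div]
    gcongr
    exact hC _
  · refine Eventually.of_forall fun z => ?_
    have : Continuous (fun e : ℝ => K k e (√(‖z‖^2 + 1)) * φ (x + e • z)) := by
      unfold K
      fun_prop
    have := (this.tendsto 0).mono_left (nhdsWithin_le_nhds (s := Set.Ioi 0))
    simpa [K] using this

lemma int_g (k : ℝ) (hk : 0 < k) (x : E3) :
    Integrable (fun y : E3 => F0 k (‖y - x‖^2)) := by
  have h : Integrable (fun y : E3 => F0 k (‖y‖^2)) := by
    have := integrable_fun_norm_addHaar (volume : Measure E3) (f := fun r => F0 k (r^2))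
    rw [this, finrank_euclideanSpace_fin]
    have h1 := integrableOn_rpow_mul_exp_neg_mul_rpow (p := 1) (s := 1) (b := k) (by norm_num)
      (by norm_num) hk
    refine h1.congr_fun (fun r hr => ?_) measurableSet_Ioi
    have hr : 0 < r := hr
    simp only [F0, Real.sqrt_sq hr.le, Real.rpow_one, smul_eq_mul]
    field_simp
  exact h.comp_sub_right x

lemma lhs_tendsto (k : ℝ) (hk : 0 < k) (x : E3) (ψ : E3 → ℝ) (hφ : Continuous ψ)
    (hsupp : HasCompactSupport ψ) :
    Tendsto (fun e : ℝ => ∫ y : E3, F0 k (‖y - x‖^2 + e^2) * ψ y) (𝓝[>] 0)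
      (𝓝 (∫ y : E3, F0 k (‖y - x‖^2) * ψ y)) := by
  obtain ⟨C, hC⟩ := hsupp.exists_bound_of_continuous hφ
  have hne : ∀ᵐ y : E3, y ≠ x := by
    simp [ae_iff]
  refine tendsto_integral_filter_of_dominated_convergence
    (fun y => F0 k (‖y - x‖^2) * C) ?_ ?_ ((int_g k hk x).mul_const _) ?_
  · filter_upwards [self_mem_nhdsWithin] with e he
    exact ((cont_F0 k e he x).mul hφ).aestronglyMeasurable
  · filter_upwards [self_mem_nhdsWithin] with e he
    filter_upwards [hne] with y hy
    have : 0 < ‖y - x‖ := norm_pos_iff.2 (sub_ne_zero.2 hy)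
    have h1 : 0 < √(‖y - x‖^2) := Real.sqrt_pos.2 (by positivity)
    have h2 : √(‖y - x‖^2) ≤ √(‖y - x‖^2 + e^2) := Real.sqrt_le_sqrt (by nlinarith [sq_nonneg e])
    rw [norm_mul, Real.norm_of_nonneg (by unfold F0; positivity)]
    refine mul_le_mul ?_ (hC y) (norm_nonneg _) (by unfold F0; positivity)
    unfold F0
    apply div_le_div₀ (Real.exp_pos _).le _ h1 h2
    apply Real.exp_le_exp.2
    nlinarith
  · filter_upwards [hne] with y hy
    have : 0 < ‖y - x‖ := norm_pos_iff.2 (sub_ne_zero.2 hy)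
    have hc := (hasDerivAt_F0 k (‖y - x‖^2 + 0^2) (by positivity)).continuousAt
    have h3 : Tendsto (fun e : ℝ => ‖y - x‖^2 + e^2) (𝓝[>] 0) (𝓝 (‖y - x‖^2 + 0^2)) :=
      ((by fun_prop : Continuous (fun e : ℝ => ‖y - x‖^2 + e^2)).tendsto 0).mono_left
        nhdsWithin_le_nhds
    have := (hc.tendsto.comp h3).mul_const (ψ y)
    simpa using this

/-- in ℝ³, g_λ^x(y) = e^{−√λ‖x−y‖}/(4π‖x−y‖) is the fundamental
solution of −Δ + λ: for every smooth compactly supported test function φ,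
∫ g_λ^x (−Δφ + λφ) = φ(x). -/
theorem stmt14 (lam : ℝ) (hlam : 0 < lam) (x : EuclideanSpace ℝ (Fin 3))
    (φ : EuclideanSpace ℝ (Fin 3) → ℝ) (hφ : ContDiff ℝ (⊤ : ℕ∞) φ) (hsupp : HasCompactSupport φ) :
    (∫ y : EuclideanSpace ℝ (Fin 3),
      (Real.exp (-(Real.sqrt lam) * ‖x - y‖) / (4 * Real.pi * ‖x - y‖)) *
        (-(∑ i : Fin 3,
            fderiv ℝ (fun z => fderiv ℝ φ z (EuclideanSpace.single i 1)) y
              (EuclideanSpace.single i 1)) + lam * φ y)) = φ x := by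
  have hk : 0 < √lam := Real.sqrt_pos.2 hlam
  have hk2 : √lam^2 = lam := Real.sq_sqrt hlam.le
  have cψ : Continuous (fun y => -(∑ i, dd φ i y) + (√lam)^2 * φ y) := by
    have := dd_cont φ hφ
    have := hφ.continuous
    fun_prop
  have sψ : HasCompactSupport (fun y => -(∑ i, dd φ i y) + (√lam)^2 * φ y) := by
    simp only [Fin.sum_univ_three]
    have := dd_supp φ hsupp
    exact (((this 0).add (this 1)).add (this 2)).neg.add hsupp.mul_left
  have hL := lhs_tendsto (√lam) hk x _ cψ sψ
  have hR := rhs_tendsto (√lam) hk x φ hφ.continuous hsupp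
  have hE : (fun e : ℝ => ∫ z : E3, K (√lam) e (√(‖z‖^2 + 1)) * φ (x + e • z)) =ᶠ[𝓝[>] 0]
      (fun e : ℝ => ∫ y : E3, F0 (√lam) (‖y - x‖^2 + e^2) * 
        (-(∑ i, dd φ i y) + (√lam)^2 * φ y)) := by
    filter_upwards [self_mem_nhdsWithin] with e he
    rw [reg_eq _ e he x φ hφ hsupp, scale_eq _ e he]
  have key := tendsto_nhds_unique hL (hR.congr' hE)
  have hfin : φ x = (4 * Real.pi)⁻¹ * (4 * Real.pi * φ x) := by
    have := Real.pi_pos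
    field_simp
  rw [hfin, ← key, ← integral_const_mul]
  congr 1
  ext y
  rw [F0, Real.sqrt_sq (norm_nonneg _), hk2, norm_sub_rev x y]
  unfold dd
  rw [div_mul_eq_div_mul_one_div, div_eq_mul_inv, one_div]
  ring
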